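/- There is no 4×4 real matrix B satisfying all of: Bᵀη = −ηB (B ∈ so(2,2)); [B, J₁] ∈ span_ℝ{J₁, J₂} and [B, J₂] ∈ span_ℝ{J₁, J₂} (B normalizes V = span{J₁, J₂}); [B, J₁] = 0; and B·(1,1,1,1) = J₁·(1,1,1,1). (This is the algebraic obstruction showing that the 6-dimensional pseudo H-type group N_{1,1} is not a geodesic orbit manifold.) -/

import Mathlib

open Matrix

noncomputable section

/-- `η = diag(1,1,−1,−1)`. -/
def η : Matrix (Fin 4) (Fin 4) ℝ := Matrix.diagonal ![1, 1, -1, -1]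

/-- The Clifford map `J_{Z₁}` of the pseudo H-type Lie algebra `n_{1,1}`. -/
def J1 : Matrix (Fin 4) (Fin 4) ℝ :=
  !![0,-1,0,0;
     1,0,0,0;
     0,0,0,-1;
     0,0,1,0]

/-- The Clifford map `J_{Z₂}` of the pseudo H-type Lie algebra `n_{1,1}`. -/
def J2 : Matrix (Fin 4) (Fin 4) ℝ :=
  !![0,0,1,0;
     0,0,0,-1;
     1,0,0,0;
     0,-1,0,0]

/-- There is no `B ∈ so(2,2)` normalizing `V = span{J₁,J₂}` with `[B,J₁] = 0`
and `B·(1,1,1,1) = J₁·(1,1,1,1)`: the obstruction showing that `N_{1,1}` is not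
geodesic orbit. -/
theorem statement14 :
    ¬ ∃ B : Matrix (Fin 4) (Fin 4) ℝ,
      B.transpose * η = -(η * B) ∧
      (B * J1 - J1 * B) ∈ Submodule.span ℝ {J1, J2} ∧
      (B * J2 - J2 * B) ∈ Submodule.span ℝ {J1, J2} ∧
      B * J1 - J1 * B = 0 ∧
      B.mulVec ![1, 1, 1, 1] = J1.mulVec ![1, 1, 1, 1] := by
  rintro ⟨B, h1, -, h3, h4, h5⟩
  obtain ⟨a, b, hab⟩ := Submodule.mem_span_pair.1 h3
  have e1 := fun i j => congrFun (congrFun h1 i) j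
  have e3 := fun i j => congrFun (congrFun hab i) j
  have e4 := fun i j => congrFun (congrFun h4 i) j
  have e5 := fun i => congrFun h5 i
  simp [Fin.forall_fin_succ, η, J1, J2, Matrix.mul_apply, Fin.sum_univ_succ, Matrix.mulVec, dotProduct, Matrix.diagonal_apply] at e1 e3 e4 e5
  casesm* _ ∧ _
  linarith

end
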